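/- Let X be a compact metric space equipped with a Borel probability measure dx, and assume there exists a sequence (g_k)_{k≥1} in X such that W₁((1/n) ∑_{k=1}^n δ_{g_k}, dx) → 0 as n → ∞. Let f : ℕ → ℕ satisfy f(N) ≥ f(N−1) + 2 for every N ≥ 1 (so f(N) ≥ 2N). Then there exists N₀ such that for every sequence (x_i)_{i≥1} in X there exists a sequence (y_j)_{j≥1} in X with the following property: for every N ≥ N₀, writing μ_N = ∑_{i=1}^N δ_{x_i} − ∑_{j=1}^{f(N)} δ_{y_j}, one has 𝐖₁^{1,1}((1/(N+f(N))) μ_N, dx) > 𝐖₁^{1,1}((1/(N+f(N))) (−μ_N), dx). In other words, if the rival opens at least two shops each time we open one, the rival has a winning strategy for all sufficiently large N. -/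

import Mathlib

open MeasureTheory Filter Metric
open scoped ENNReal

section Defs

variable {X : Type*} [MeasurableSpace X] [MetricSpace X]

/-- A transference plan (coupling) between `μ` and `ν`: a measure on `X × X`
whose marginals are `μ` and `ν`. -/
def IsCoupling (μ ν : Measure X) (π : Measure (X × X)) : Prop :=
  π.map Prod.fst = μ ∧ π.map Prod.snd = ν

/-- The 1-Wasserstein distance between two (nonnegative) measures of equal mass:
the infimum over couplings of the transport cost. -/
noncomputable def W1 (μ ν : Measure X) : ℝ :=
  sInf { r : ℝ | ∃ π : Measure (X × X), IsCoupling μ ν π ∧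
    r = ∫ p : X × X, dist p.1 p.2 ∂π }

/-- The total variation norm `‖μ - ν‖` of the difference of two finite measures. -/
noncomputable def tvNorm (μ ν : Measure X) : ℝ :=
  ((μ - ν) Set.univ + (ν - μ) Set.univ).toReal

/-- The generalized Wasserstein distance `W₁^{a,b}` between two finite nonnegative
measures, possibly of different total mass (Piccoli–Rossi). -/
noncomputable def genW (a b : ℝ) (μ ν : Measure X) : ℝ :=
  sInf { r : ℝ | ∃ μ' ν' : Measure X, IsFiniteMeasure μ' ∧ IsFiniteMeasure ν' ∧
    μ' Set.univ = ν' Set.univ ∧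
    r = a * (tvNorm μ μ' + tvNorm ν ν') + b * W1 μ' ν' }

/-- The signed generalized Wasserstein distance `𝐖₁^{a,b}` between finite signed
measures, defined via the Jordan decompositions. -/
noncomputable def signedW (a b : ℝ) (μ ν : SignedMeasure X) : ℝ :=
  genW a b (μ.toJordanDecomposition.posPart + ν.toJordanDecomposition.negPart)
    (μ.toJordanDecomposition.negPart + ν.toJordanDecomposition.posPart)

/-- The empirical (probability) measure of the first `n` points of a sequence. -/
noncomputable def emp (x : ℕ → X) (n : ℕ) : Measure X :=
  (n : ℝ≥0∞)⁻¹ • ∑ k ∈ Finset.range n, Measure.dirac (x k)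

/-- The (unnormalized) empirical signed measure of the first `n` points of a sequence. -/
noncomputable def sEmp (x : ℕ → X) (n : ℕ) : SignedMeasure X :=
  ∑ k ∈ Finset.range n, (Measure.dirac (x k)).toSignedMeasure

end Defs

section WassersteinBounds

variable {X : Type*} [MeasurableSpace X]

lemma toJordanDecomposition_toSignedMeasure_posPart (μ : Measure X) [IsFiniteMeasure μ] :
    μ.toSignedMeasure.toJordanDecomposition.posPart = μ := by
  have h := Measure.toJordanDecomposition_toSignedMeasure_sub (μ := μ) (ν := 0)
  rw [Measure.toSignedMeasure_zero, sub_zero] at h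
  rw [h, Measure.jordanDecompositionOfToSignedMeasureSub_posPart, Measure.sub_zero]

lemma toJordanDecomposition_toSignedMeasure_negPart (μ : Measure X) [IsFiniteMeasure μ] :
    μ.toSignedMeasure.toJordanDecomposition.negPart = 0 := by
  have h := Measure.toJordanDecomposition_toSignedMeasure_sub (μ := μ) (ν := 0)
  rw [Measure.toSignedMeasure_zero, sub_zero] at h
  rw [h, Measure.jordanDecompositionOfToSignedMeasureSub_negPart, Measure.zero_sub]

lemma tvNorm_nonneg (μ ν : Measure X) : 0 ≤ tvNorm μ ν :=
  ENNReal.toReal_nonneg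

lemma tvNorm_self (μ : Measure X) : tvNorm μ μ = 0 := by
  simp [tvNorm, Measure.sub_self]

lemma tvNorm_zero_left (μ : Measure X) : tvNorm 0 μ = μ.real Set.univ := by
  simp [tvNorm, Measure.zero_sub, Measure.sub_zero, measureReal_def]

lemma measureReal_univ_le_add_tvNorm (μ ν : Measure X) [IsFiniteMeasure μ] [IsFiniteMeasure ν] :
    μ.real Set.univ ≤ ν.real Set.univ + tvNorm μ ν := by
  have h : μ ≤ (μ - ν) + ν := Measure.sub_le_iff_le_add.1 le_rfl
  have h' : μ Set.univ ≤ ν Set.univ + ((μ - ν) Set.univ + (ν - μ) Set.univ) := by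
    refine (h Set.univ).trans ?_
    rw [Measure.add_apply, add_comm]
    gcongr
    exact le_self_add
  rw [measureReal_def, measureReal_def, tvNorm, ← ENNReal.toReal_add (by finiteness) (by finiteness)]
  exact ENNReal.toReal_mono (by finiteness) h'

lemma tvNorm_smul_self (μ : Measure X) [IsProbabilityMeasure μ] {t : NNReal} (ht : t ≤ 1) :
    tvNorm μ (t • μ) = 1 - t := by
  have hadd : μ = (1 - t) • μ + t • μ := by
    rw [← add_smul, tsub_add_cancel_of_le ht, one_smul]
  have h1 : μ - t • μ = (1 - t) • μ := by
    have h := Measure.add_sub_cancel (μ := (1 - t) • μ) (ν := t • μ)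
    rwa [← hadd] at h
  have h2 : t • μ - μ = 0 :=
    Measure.sub_eq_zero_of_le ((Measure.le_add_left le_rfl).trans_eq hadd.symm)
  rw [tvNorm, h1, h2, Measure.coe_zero, Pi.zero_apply, add_zero, ← measureReal_def,
    measureReal_nnreal_smul_apply, probReal_univ, mul_one, NNReal.coe_sub ht, NNReal.coe_one]

lemma IsCoupling.smul {μ ν : Measure X} {π : Measure (X × X)} (h : IsCoupling μ ν π)
    (t : NNReal) : IsCoupling (t • μ) (t • ν) (t • π) := by
  constructor
  · rw [Measure.map_smul, h.1]
  · rw [Measure.map_smul, h.2]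

lemma isCoupling_prod (μ ν : Measure X) [IsProbabilityMeasure μ] [IsProbabilityMeasure ν] :
    IsCoupling μ ν (μ.prod ν) := by
  simp [IsCoupling]

lemma isProbabilityMeasure_emp (x : ℕ → X) {n : ℕ} (hn : n ≠ 0) :
    IsProbabilityMeasure (emp x n) := by
  refine ⟨?_⟩
  rw [emp, Measure.smul_apply, Measure.finsetSum_apply]
  simp [ENNReal.inv_mul_cancel, hn]

lemma sEmp_eq_smul_emp (x : ℕ → X) {n : ℕ} (hn : n ≠ 0) [IsFiniteMeasure (emp x n)] :
    sEmp x n = (n : NNReal) • (emp x n).toSignedMeasure := by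
  have hsum : (n : NNReal) • emp x n = ∑ k ∈ Finset.range n, Measure.dirac (x k) := by
    ext s
    simp only [emp, Measure.smul_apply, ENNReal.smul_def, smul_eq_mul, ENNReal.coe_natCast]
    rw [← mul_assoc, ENNReal.mul_inv_cancel (by simpa using hn) (by simp), one_mul]
  rw [← Measure.toSignedMeasure_smul, Measure.toSignedMeasure_congr hsum]
  clear hsum hn
  ext s hs
  rw [Measure.toSignedMeasure_apply_measurable hs, measureReal_def, Measure.finsetSum_apply,
    ENNReal.toReal_sum (by finiteness), sEmp, _root_.sum_apply]
  exact Finset.sum_congr rfl fun k _ => Measure.toSignedMeasure_apply_measurable hs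

variable [MetricSpace X]

lemma W1_nonneg (μ ν : Measure X) : 0 ≤ W1 μ ν := by
  refine Real.sInf_nonneg ?_
  rintro r ⟨π, -, rfl⟩
  exact integral_nonneg fun _ => dist_nonneg

lemma W1_le_integral {μ ν : Measure X} {π : Measure (X × X)} (h : IsCoupling μ ν π) :
    W1 μ ν ≤ ∫ p, dist p.1 p.2 ∂π := by
  refine csInf_le ⟨0, ?_⟩ ⟨π, h, rfl⟩
  rintro r ⟨π', -, rfl⟩
  exact integral_nonneg fun _ => dist_nonneg

lemma W1_smul_le (μ ν : Measure X) [IsProbabilityMeasure μ] [IsProbabilityMeasure ν]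
    (t : NNReal) : W1 (t • μ) (t • ν) ≤ t * W1 μ ν := by
  refine le_of_forall_pos_le_add fun ε hε => ?_
  have hδ : 0 < ε / (t + 1) := by positivity
  obtain ⟨r, ⟨π, hπ, rfl⟩, hr⟩ := Real.lt_sInf_add_pos
    (s := {r : ℝ | ∃ π : Measure (X × X), IsCoupling μ ν π ∧ r = ∫ p, dist p.1 p.2 ∂π})
    ⟨_, μ.prod ν, isCoupling_prod μ ν, rfl⟩ hδ
  have hcost := W1_le_integral (hπ.smul t)
  rw [integral_smul_nnreal_measure, NNReal.smul_def, smul_eq_mul] at hcost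
  have hmul : (t : ℝ) * (ε / (t + 1)) ≤ ε := by
    rw [mul_div_assoc', div_le_iff₀ (by positivity)]
    nlinarith
  calc W1 (t • μ) (t • ν) ≤ t * ∫ p, dist p.1 p.2 ∂π := hcost
    _ ≤ t * (W1 μ ν + ε / (t + 1)) := by
        gcongr
        exact hr.le
    _ ≤ t * W1 μ ν + ε := by linarith

lemma measureReal_univ_le_genW_zero (ν : Measure X) [IsFiniteMeasure ν] :
    ν.real Set.univ ≤ genW 1 1 0 ν := by
  refine le_csInf ⟨_, 0, 0, inferInstance, inferInstance, rfl, rfl⟩ ?_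
  rintro r ⟨μ', ν', hμ', hν', heq, rfl⟩
  have hmass : μ'.real Set.univ = ν'.real Set.univ := by rw [measureReal_def, heq, measureReal_def]
  have h := measureReal_univ_le_add_tvNorm ν ν'
  have hW := W1_nonneg μ' ν'
  rw [tvNorm_zero_left]
  linarith

lemma genW_smul_le (μ ν : Measure X) [IsProbabilityMeasure μ] [IsProbabilityMeasure ν]
    {t : NNReal} (ht : t ≤ 1) : genW 1 1 (t • μ) ν ≤ 1 - t + t * W1 μ ν := by
  have hle : genW 1 1 (t • μ) ν ≤
      1 * (tvNorm (t • μ) (t • μ) + tvNorm ν (t • ν)) + 1 * W1 (t • μ) (t • ν) := by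
    refine csInf_le ⟨0, ?_⟩ ⟨t • μ, t • ν, inferInstance, inferInstance, by simp, rfl⟩
    rintro r ⟨μ', ν', -, -, -, rfl⟩
    have h1 := tvNorm_nonneg (t • μ) μ'
    have h2 := tvNorm_nonneg ν ν'
    have h3 := W1_nonneg μ' ν'
    linarith
  rw [tvNorm_self, tvNorm_smul_self ν ht] at hle
  linarith [W1_smul_le μ ν t]

lemma signedW_smul_lt_signedW_neg_smul (μ ν : Measure X) [IsProbabilityMeasure μ]
    [IsProbabilityMeasure ν] (hW : W1 μ ν < 2) {t : NNReal} (ht0 : 0 < t) (ht : t ≤ 1) :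
    signedW 1 1 (t • μ.toSignedMeasure) ν.toSignedMeasure <
      signedW 1 1 (-(t • μ.toSignedMeasure)) ν.toSignedMeasure := by
  rw [← Measure.toSignedMeasure_smul]
  simp only [signedW, SignedMeasure.toJordanDecomposition_neg, JordanDecomposition.neg_posPart,
    JordanDecomposition.neg_negPart, toJordanDecomposition_toSignedMeasure_posPart,
    toJordanDecomposition_toSignedMeasure_negPart, add_zero, zero_add]
  have hupper := genW_smul_le μ ν ht
  have hlower := measureReal_univ_le_genW_zero (t • μ + ν)
  rw [measureReal_add_apply, measureReal_nnreal_smul_apply, probReal_univ, probReal_univ] at hlower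
  have hpos : (0 : ℝ) < t := ht0
  nlinarith

end WassersteinBounds

section Interleaving

open Classical in
/-- The sequence running through `x` along the indices satisfying `p` and through `g` along the
remaining ones. -/
noncomputable def interleave {X : Type*} (p : ℕ → Prop) (x g : ℕ → X) (j : ℕ) : X :=
  if p j then x (Nat.count p j) else g (j - Nat.count p j)

open Classical in
lemma sum_range_interleave {X M : Type*} [AddCommMonoid M] (p : ℕ → Prop) (x g : ℕ → X)
    (F : X → M) (n : ℕ) :
    ∑ j ∈ Finset.range n, F (interleave p x g j) =
      ∑ i ∈ Finset.range (Nat.count p n), F (x i) +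
        ∑ k ∈ Finset.range (n - Nat.count p n), F (g k) := by
  induction n with
  | zero => simp
  | succ n ih =>
    have hle : Nat.count p n ≤ n := Nat.count_le p
    rw [Finset.sum_range_succ, ih, interleave, Nat.count_succ]
    split_ifs with h
    · rw [Finset.sum_range_succ, Nat.add_sub_add_right, add_right_comm]
    · rw [add_zero, Nat.succ_sub hle, Finset.sum_range_succ, add_assoc]

open Classical in
lemma StrictMono.count_mem_range {f : ℕ → ℕ} (hf : StrictMono f) (n : ℕ) :
    Nat.count (· ∈ Set.range f) (f n) = n := by
  have h : {k ∈ Finset.range (f n) | k ∈ Set.range f} = (Finset.range n).image f := by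
    ext k
    simp only [Finset.mem_filter, Finset.mem_range, Set.mem_range, Finset.mem_image]
    constructor
    · rintro ⟨hk, i, rfl⟩
      exact ⟨i, hf.lt_iff_lt.1 hk, rfl⟩
    · rintro ⟨i, hi, rfl⟩
      exact ⟨hf hi, i, rfl⟩
  rw [Nat.count_eq_card_filter_range, h, Finset.card_image_of_injective _ hf.injective,
    Finset.card_range]

end Interleaving

/-- If there exists a sequence whose empirical measures converge to `dx`
in `W₁`, and the rival opens at least two shops each time we open one
(`f N ≥ f (N−1) + 2`), then for all sufficiently large `N` the rival has a winning
strategy: for any sequence `x` there is a sequence `y` with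
`𝐖₁^{1,1}(μ_N/(N+f N), dx) > 𝐖₁^{1,1}(−μ_N/(N+f N), dx)` for all `N ≥ N₀`,
where `μ_N = ∑_{i=1}^N δ_{x_i} − ∑_{j=1}^{f N} δ_{y_j}`. -/
theorem rival_wins_of_double_growth {X : Type*} [MeasurableSpace X] [MetricSpace X]
    [BorelSpace X] [CompactSpace X] (dx : Measure X) [IsProbabilityMeasure dx]
    (hg : ∃ g : ℕ → X, Tendsto (fun n : ℕ => W1 (emp g n) dx) atTop (nhds 0))
    (f : ℕ → ℕ) (hf : ∀ N : ℕ, 1 ≤ N → f (N - 1) + 2 ≤ f N) :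
    ∃ N₀ : ℕ, ∀ x : ℕ → X, ∃ y : ℕ → X, ∀ N, N₀ ≤ N →
      signedW 1 1
          (((N + f N : ℕ) : ℝ)⁻¹ • (-(sEmp x N - sEmp y (f N))))
          dx.toSignedMeasure <
        signedW 1 1
          (((N + f N : ℕ) : ℝ)⁻¹ • (sEmp x N - sEmp y (f N)))
          dx.toSignedMeasure := by
  obtain ⟨g, hg⟩ := hg
  obtain ⟨n₀, hn₀⟩ := eventually_atTop.1 (hg.eventually_lt_const two_pos)
  have hmono : StrictMono f := strictMono_nat_of_lt_succ fun n => by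
    have := hf (n + 1) (by omega)
    rw [Nat.add_sub_cancel] at this
    omega
  have hdouble (n : ℕ) : 2 * n ≤ f n := by
    induction n with
    | zero => omega
    | succ n ih =>
      have := hf (n + 1) (by omega)
      rw [Nat.add_sub_cancel] at this
      omega
  refine ⟨n₀ + 1, fun x => ⟨interleave (· ∈ Set.range f) x g, fun N hN => ?_⟩⟩
  have hfN := hdouble N
  have hm : f N - N ≠ 0 := by omega
  have := isProbabilityMeasure_emp g hm
  have hsub : sEmp x N - sEmp (interleave (· ∈ Set.range f) x g) (f N) = -sEmp g (f N - N) := by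
    simp only [sEmp]
    rw [sum_range_interleave _ x g (fun z => (Measure.dirac z).toSignedMeasure),
      hmono.count_mem_range]
    abel
  have hscale : ((N + f N : ℕ) : ℝ)⁻¹ • sEmp g (f N - N) =
      (((N + f N : ℕ) : NNReal)⁻¹ * ((f N - N : ℕ) : NNReal)) •
        (emp g (f N - N)).toSignedMeasure := by
    rw [sEmp_eq_smul_emp g hm, mul_smul]
    simp [NNReal.smul_def]
  rw [hsub, neg_neg, smul_neg, hscale]
  refine signedW_smul_lt_signedW_neg_smul _ dx (hn₀ _ (by omega)) ?_ ?_
  · have h1 : (0 : NNReal) < (N + f N : ℕ) := by exact_mod_cast (by omega : 0 < N + f N)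
    have h2 : (0 : NNReal) < (f N - N : ℕ) := by exact_mod_cast (by omega : 0 < f N - N)
    positivity
  · have h1 : (0 : NNReal) < (N + f N : ℕ) := by exact_mod_cast (by omega : 0 < N + f N)
    rw [inv_mul_le_iff₀ h1, mul_one]
    exact_mod_cast (by omega : f N - N ≤ N + f N)
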